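/- Let r be a positive integer and k ∈ ℕ. Then the success probability of the generalized parity measurement on a coherent state tends to 1/r as the mean photon number grows: lim_{x → ∞} e^{−x} · ∑'_{n ∈ ℕ, n ≡ k (mod r)} xⁿ/n! = 1/r, where the limit is over real x → ∞. -/

import Mathlib

open Filter Topology

theorem IsPrimitiveRoot.pow_eq_pow_iff_mod_eq {R : Type*} [CommMonoid R] {ζ : R} {r : ℕ}
    (hζ : IsPrimitiveRoot ζ r) (hr : 0 < r) (n k : ℕ) : ζ ^ n = ζ ^ k ↔ n % r = k % r := by
  have hmod (m : ℕ) : ζ ^ m = ζ ^ (m % r) := by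
    conv_lhs => rw [← Nat.mod_add_div m r, pow_add, pow_mul, hζ.pow_eq_one, one_pow, mul_one]
  refine ⟨fun h => ?_, fun h => by rw [hmod n, hmod k, h]⟩
  rw [hmod n, hmod k] at h
  exact hζ.pow_inj (Nat.mod_lt _ hr) (Nat.mod_lt _ hr) h

/-- The roots of unity filter. -/
theorem IsPrimitiveRoot.sum_pow_mul_inv_pow {K : Type*} [Field K] {ζ : K} {r : ℕ}
    (hζ : IsPrimitiveRoot ζ r) (hr : 0 < r) (n k : ℕ) :
    ∑ j ∈ Finset.range r, (ζ ^ n * (ζ ^ k)⁻¹) ^ j = if n % r = k % r then (r : K) else 0 := by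
  have hk : ζ ^ k ≠ 0 := pow_ne_zero _ (hζ.ne_zero hr.ne')
  split_ifs with h
  · simp [(hζ.pow_eq_pow_iff_mod_eq hr n k).2 h, mul_inv_cancel₀ hk]
  · have hw : ζ ^ n * (ζ ^ k)⁻¹ ≠ 1 := fun hw =>
      h ((hζ.pow_eq_pow_iff_mod_eq hr n k).1 ((mul_inv_eq_one₀ hk).1 hw))
    have hwr : (ζ ^ n * (ζ ^ k)⁻¹) ^ r = 1 := by
      rw [mul_pow, inv_pow, ← pow_mul, ← pow_mul, mul_comm n, mul_comm k, pow_mul, pow_mul,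
        hζ.pow_eq_one]
      simp
    rw [geom_sum_eq hw, hwr, sub_self, zero_div]

/-- The part of the exponential series with indices congruent to `k` modulo `r`. -/
theorem IsPrimitiveRoot.hasSum_exp_series_mod {ζ : ℂ} {r : ℕ} (hζ : IsPrimitiveRoot ζ r)
    (hr : 0 < r) (k : ℕ) (z : ℂ) :
    HasSum (fun n : ℕ => if n % r = k % r then z ^ n / (n.factorial : ℂ) else 0)
      ((r : ℂ)⁻¹ * ∑ j ∈ Finset.range r, ((ζ ^ k)⁻¹) ^ j * Complex.exp (ζ ^ j * z)) := by
  have hexp (w : ℂ) : HasSum (fun n : ℕ => w ^ n / (n.factorial : ℂ)) (Complex.exp w) := by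
    rw [Complex.exp_eq_exp_ℂ]
    exact NormedSpace.expSeries_div_hasSum_exp w
  have hr0 : (r : ℂ) ≠ 0 := Nat.cast_ne_zero.2 hr.ne'
  have h := (hasSum_sum fun j (_ : j ∈ Finset.range r) =>
    (hexp (ζ ^ j * z)).mul_left (((ζ ^ k)⁻¹) ^ j)).mul_left ((r : ℂ)⁻¹)
  convert h using 1
  · rfl
  funext n
  have hterm (j : ℕ) : ((ζ ^ k)⁻¹) ^ j * ((ζ ^ j * z) ^ n / (n.factorial : ℂ)) =
      (ζ ^ n * (ζ ^ k)⁻¹) ^ j * (z ^ n / (n.factorial : ℂ)) := by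
    rw [mul_pow, mul_pow, ← pow_mul, ← pow_mul ζ n j, mul_comm j n]
    ring
  simp_rw [hterm]
  rw [← Finset.sum_mul, hζ.sum_pow_mul_inv_pow hr]
  split_ifs
  · rw [inv_mul_cancel_left₀ hr0]
  · simp

theorem Complex.re_lt_one_of_norm_eq_one {z : ℂ} (hz : ‖z‖ = 1) (h1 : z ≠ 1) : z.re < 1 := by
  refine lt_of_le_of_ne (hz ▸ Complex.re_le_norm z) fun hre => h1 ?_
  have h := Complex.sq_norm z
  rw [hz, Complex.normSq_apply, hre] at h
  exact Complex.ext hre (by simpa using h)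

theorem Complex.tendsto_exp_mul_ofReal_atTop {a : ℂ} (ha : a.re < 0) :
    Tendsto (fun x : ℝ => Complex.exp (a * x)) atTop (𝓝 0) := by
  rw [Complex.tendsto_exp_nhds_zero_iff]
  simpa using tendsto_id.const_mul_atTop_of_neg ha

/-- The success probability of the generalized parity measurement on a coherent state with
mean photon number `x` tends to `1/r` as `x → ∞`:
`e^{-x} ∑_{n ≡ k (mod r)} xⁿ/n! → 1/r`. -/
theorem stmt16 (r : ℕ) (hr : 0 < r) (k : ℕ) :
    Filter.Tendsto
      (fun x : ℝ =>
        Real.exp (-x) * ∑' n : ℕ, if n % r = k % r then x ^ n / (n.factorial : ℝ) else 0)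
      Filter.atTop (nhds (1 / (r : ℝ))) := by
  have hζ := Complex.isPrimitiveRoot_exp r hr.ne'
  set ζ := Complex.exp (2 * Real.pi * Complex.I / r)
  have hlim (j : ℕ) (hj : j ∈ Finset.range r) :
      Tendsto (fun x : ℝ => ((ζ ^ k)⁻¹) ^ j * Complex.exp ((ζ ^ j - 1) * x)) atTop
        (𝓝 (if j = 0 then 1 else 0)) := by
    split_ifs with h0
    · simp [h0]
    · have hre : (ζ ^ j - 1).re < 0 := by
        have := Complex.re_lt_one_of_norm_eq_one
          (by rw [norm_pow, hζ.norm'_eq_one hr.ne', one_pow] : ‖ζ ^ j‖ = 1)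
          (hζ.pow_ne_one_of_pos_of_lt h0 (Finset.mem_range.1 hj))
        simpa using this
      simpa using (Complex.tendsto_exp_mul_ofReal_atTop hre).const_mul (((ζ ^ k)⁻¹) ^ j)
  have hsum := (tendsto_finsetSum _ hlim).const_mul ((r : ℂ)⁻¹)
  rw [Finset.sum_ite_eq' (Finset.range r) 0, if_pos (Finset.mem_range.2 hr), mul_one] at hsum
  rw [← Filter.tendsto_ofReal_iff]
  convert hsum using 2 with x
  · have htsum := (hζ.hasSum_exp_series_mod hr k x).tsum_eq
    push_cast [apply_ite Complex.ofReal]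
    rw [htsum, mul_left_comm, Finset.mul_sum]
    congr 1
    refine Finset.sum_congr rfl fun j _ => ?_
    rw [mul_left_comm, ← Complex.exp_add]
    ring_nf
  · simp
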